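/- arXiv:1507.04238 — 2 statements merged into one kernel-verified Lean document; each statement's English description precedes it below -/
import Mathlib

section
/- Let 0 < x_c < 1 and define on ℝ the shape functions N₁(t) = 1 − t, N₂(t) = t, the level set φ(t) = t − x_c, the enrichment ψ(t) = sign(φ(t)), and the shifted extended basis functions M₁(t) = N₁(t)·(ψ(t) − ψ(0)), M₂(t) = N₂(t)·(ψ(t) − ψ(1)). Given boundary data values G₁, G₂ ∈ ℝ and coefficients a₁, a₂ ∈ ℝ, let u_h(t) = G₁·N₁(t) + G₂·N₂(t) + a₁·M₁(t) + a₂·M₂(t). Then for any c₂ ∈ ℝ, the one-sided limit of u_h(t) as t → x_c from the right equals c₂ if and only if a₁ = (c₂ − G₁·N₁(x_c) − G₂·N₂(x_c)) / (2·N₁(x_c)). -/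
/-- Discontinuous Dirichlet data via XFEM on a boundary edge `[0,1]` cut at `x_c`:
with `N₁(t) = 1 − t`, `N₂(t) = t`, `ψ(t) = sign(t − x_c)`,
`M₁(t) = N₁(t)(ψ(t) − ψ(0))`, `M₂(t) = N₂(t)(ψ(t) − ψ(1))` and
`u_h = G₁N₁ + G₂N₂ + a₁M₁ + a₂M₂`, the right-sided limit of `u_h` at `x_c` equals `c₂`
iff `a₁ = (c₂ − G₁N₁(x_c) − G₂N₂(x_c)) / (2N₁(x_c))`. -/
theorem stmt_12 (x_c : ℝ) (hx0 : 0 < x_c) (hx1 : x_c < 1)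
    (N₁ N₂ ψ M₁ M₂ : ℝ → ℝ)
    (hN₁ : N₁ = fun t => 1 - t) (hN₂ : N₂ = fun t => t)
    (hψ : ψ = fun t => Real.sign (t - x_c))
    (hM₁ : M₁ = fun t => N₁ t * (ψ t - ψ 0))
    (hM₂ : M₂ = fun t => N₂ t * (ψ t - ψ 1))
    (G₁ G₂ a₁ a₂ : ℝ) (u_h : ℝ → ℝ)
    (hu_h : u_h = fun t => G₁ * N₁ t + G₂ * N₂ t + a₁ * M₁ t + a₂ * M₂ t)
    (c₂ : ℝ) :
    Filter.Tendsto u_h (nhdsWithin x_c (Set.Ioi x_c)) (nhds c₂) ↔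
      a₁ = (c₂ - G₁ * N₁ x_c - G₂ * N₂ x_c) / (2 * N₁ x_c) := by
  have h0 : Real.sign (0 - x_c) = -1 := Real.sign_of_neg (by linarith)
  have h1 : Real.sign (1 - x_c) = 1 := Real.sign_of_pos (by linarith)
  have hlim : Filter.Tendsto u_h (nhdsWithin x_c (Set.Ioi x_c))
      (nhds (G₁ * (1 - x_c) + G₂ * x_c + a₁ * ((1 - x_c) * 2))) := by
    have hc : Continuous (fun t : ℝ => G₁ * (1 - t) + G₂ * t + a₁ * ((1 - t) * 2)) := by
      fun_prop
    refine ((hc.tendsto x_c).mono_left nhdsWithin_le_nhds).congr' ?_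
    filter_upwards [self_mem_nhdsWithin] with t ht
    have h2 : Real.sign (t - x_c) = 1 := Real.sign_of_pos (sub_pos.mpr ht)
    simp only [hu_h, hM₁, hM₂, hψ, hN₁, hN₂, h0, h1, h2]
    ring
  have hne : (2 * (1 - x_c)) ≠ 0 := by
    have : 0 < 1 - x_c := by linarith
    positivity
  simp only [hN₁, hN₂]
  rw [eq_div_iff hne]
  constructor
  · intro h
    have := tendsto_nhds_unique h hlim
    linarith
  · intro h
    have : c₂ = G₁ * (1 - x_c) + G₂ * x_c + a₁ * ((1 - x_c) * 2) := by linarith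
    rw [this]
    exact hlim
end

section
/- Let 0 < x_c < 1 and define on ℝ the shape functions N₁(t) = 1 − t, N₂(t) = t, the level set φ(t) = t − x_c, the enrichment ψ(t) = sign(φ(t)), and the shifted extended basis functions M₁(t) = N₁(t)·(ψ(t) − ψ(0)), M₂(t) = N₂(t)·(ψ(t) − ψ(1)). Given boundary data values G₁, G₂ ∈ ℝ and coefficients a₁, a₂ ∈ ℝ, let u_h(t) = G₁·N₁(t) + G₂·N₂(t) + a₁·M₁(t) + a₂·M₂(t). Then for any c₁ ∈ ℝ, the one-sided limit of u_h(t) as t → x_c from the left equals c₁ if and only if a₂ = (c₁ − G₁·N₁(x_c) − G₂·N₂(x_c)) / (−2·N₂(x_c)). -/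
/-- Discontinuous Dirichlet data via XFEM on a boundary edge `[0,1]` cut at `x_c`:
with `N₁(t) = 1 − t`, `N₂(t) = t`, `ψ(t) = sign(t − x_c)`,
`M₁(t) = N₁(t)(ψ(t) − ψ(0))`, `M₂(t) = N₂(t)(ψ(t) − ψ(1))` and
`u_h = G₁N₁ + G₂N₂ + a₁M₁ + a₂M₂`, the left-sided limit of `u_h` at `x_c` equals `c₁`
iff `a₂ = (c₁ − G₁N₁(x_c) − G₂N₂(x_c)) / (−2N₂(x_c))`. -/
theorem stmt_13 (x_c : ℝ) (hx0 : 0 < x_c) (hx1 : x_c < 1)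
    (N₁ N₂ ψ M₁ M₂ : ℝ → ℝ)
    (hN₁ : N₁ = fun t => 1 - t) (hN₂ : N₂ = fun t => t)
    (hψ : ψ = fun t => Real.sign (t - x_c))
    (hM₁ : M₁ = fun t => N₁ t * (ψ t - ψ 0))
    (hM₂ : M₂ = fun t => N₂ t * (ψ t - ψ 1))
    (G₁ G₂ a₁ a₂ : ℝ) (u_h : ℝ → ℝ)
    (hu_h : u_h = fun t => G₁ * N₁ t + G₂ * N₂ t + a₁ * M₁ t + a₂ * M₂ t)
    (c₁ : ℝ) :
    Filter.Tendsto u_h (nhdsWithin x_c (Set.Iio x_c)) (nhds c₁) ↔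
      a₂ = (c₁ - G₁ * N₁ x_c - G₂ * N₂ x_c) / (-2 * N₂ x_c) := by
  have key : Filter.Tendsto u_h (nhdsWithin x_c (Set.Iio x_c))
      (nhds (G₁ * (1 - x_c) + G₂ * x_c + a₂ * (x_c * (-2)))) := by
    have hc : Continuous (fun t : ℝ => G₁ * (1 - t) + G₂ * t + a₂ * (t * (-2))) := by
      fun_prop
    have ht := (hc.tendsto x_c).mono_left (nhdsWithin_le_nhds (s := Set.Iio x_c))
    refine ht.congr' ?_
    filter_upwards [self_mem_nhdsWithin] with t htm
    have h1 : t - x_c < 0 := sub_neg.mpr htm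
    have h2 : (0 : ℝ) - x_c < 0 := by linarith
    have h3 : 0 < 1 - x_c := by linarith
    simp only [hu_h, hM₁, hM₂, hψ, hN₁, hN₂, Real.sign_of_neg h1, Real.sign_of_neg h2,
      Real.sign_of_pos h3]
    ring
  have hne : -2 * x_c ≠ 0 := by
    have := hx0.ne'
    simpa using this
  simp only [hN₁, hN₂]
  rw [eq_div_iff hne]
  constructor
  · intro h
    have := tendsto_nhds_unique h key
    rw [this]
    ring
  · intro h
    have e : c₁ = G₁ * (1 - x_c) + G₂ * x_c + a₂ * (x_c * (-2)) := by linarith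
    rw [e]
    exact key
end
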